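/- If u and v are packed words that each avoid all four patterns 132, 213, 121 and 212, then the packed word u∨v avoids all four patterns 132, 213, 121 and 212. (This gives a direct proof that the free cubical trialgebra on one generator is stable under the # product.) -/

import Mathlib

/-- The packed word of `u`: if the distinct letters of `u` are `b₁ < b₂ < … < b_r`,
then `pack u` is the image of `u` under the substitution `b_i ↦ i`. -/
def pack (u : List ℕ) : List ℕ :=
  u.map (fun x => (u.toFinset.filter (fun y => y ≤ x)).card)

/-- A word is packed if it is its own packed word. -/
def IsPacked (u : List ℕ) : Prop := pack u = u

/-- The largest letter of a word. -/
def maxL (u : List ℕ) : ℕ := u.foldr max 0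

/-- The packed word `u ∨ v` (lengths `k`, `l`): the first `k` letters are
`u_i + v₁ − 1` if `u_i ≤ u_k` and `u_i + max(v) − 1` if `u_i > u_k`, followed, for
`2 ≤ i ≤ l`, by `v_i` if `v_i < v₁` and `v_i + u_k − 1` if `v_i ≥ v₁`. -/
def veeP (u v : List ℕ) : List ℕ :=
  (u.map (fun x => if x ≤ u.getD (u.length - 1) 0 then x + v.getD 0 0 - 1
      else x + maxL v - 1)) ++
    ((v.drop 1).map (fun y => if y < v.getD 0 0 then y
      else y + u.getD (u.length - 1) 0 - 1))

/-- A word `w` avoids a packed word `p` of length 3 as a pattern if there are no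
positions `i < j < m` (0-indexed here) such that `pack (w_i w_j w_m) = p`. -/
def AvoidsPat (w p : List ℕ) : Prop :=
  ∀ i j m, i < j → j < m → m < w.length →
    pack [w.getD i 0, w.getD j 0, w.getD m 0] ≠ p

/-- The entries `a, b, c` do not form any of the patterns 132, 213, 121, 212. -/
theorem pack_avoids_cubical_iff (a b c : ℕ) :
    (pack [a, b, c] ≠ [1, 3, 2] ∧ pack [a, b, c] ≠ [2, 1, 3] ∧
      pack [a, b, c] ≠ [1, 2, 1] ∧ pack [a, b, c] ≠ [2, 1, 2]) ↔
      (a ≤ c → a ≤ b ∧ b ≤ c) := by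
  rcases lt_trichotomy a b with hab | hab | hab <;>
  rcases lt_trichotomy b c with hbc | hbc | hbc <;>
  rcases lt_trichotomy a c with hac | hac | hac <;>
  first
  | omega
  | subst_vars
    simp [pack, Finset.filter_insert, Finset.filter_singleton, Finset.card_insert_of_notMem,
      *, not_le_of_gt, ne_of_gt, ne_of_lt, le_of_lt]

/-- A word avoids the four cubical patterns iff every three entries in order `a, b, c` with
`a ≤ c` satisfy `a ≤ b ≤ c`. -/
theorem avoidsPat_cubical_iff (w : List ℕ) :
    (AvoidsPat w [1, 3, 2] ∧ AvoidsPat w [2, 1, 3] ∧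
      AvoidsPat w [1, 2, 1] ∧ AvoidsPat w [2, 1, 2]) ↔
      ∀ i j m, i < j → j < m → m < w.length → w.getD i 0 ≤ w.getD m 0 →
        w.getD i 0 ≤ w.getD j 0 ∧ w.getD j 0 ≤ w.getD m 0 := by
  constructor
  · rintro ⟨h₁, h₂, h₃, h₄⟩ i j m hij hjm hm
    exact (pack_avoids_cubical_iff _ _ _).1 ⟨h₁ i j m hij hjm hm, h₂ i j m hij hjm hm,
      h₃ i j m hij hjm hm, h₄ i j m hij hjm hm⟩
  · intro h
    have key := fun i j m hij hjm hm => (pack_avoids_cubical_iff _ _ _).2 (h i j m hij hjm hm)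
    exact ⟨fun i j m hij hjm hm => (key i j m hij hjm hm).1,
      fun i j m hij hjm hm => (key i j m hij hjm hm).2.1,
      fun i j m hij hjm hm => (key i j m hij hjm hm).2.2.1,
      fun i j m hij hjm hm => (key i j m hij hjm hm).2.2.2⟩

theorem IsPacked.one_le_getD {u : List ℕ} (hu : IsPacked u) {i : ℕ} (hi : i < u.length) :
    1 ≤ u.getD i 0 := by
  have hmem : u.getD i 0 ∈ pack u := by
    rw [hu, List.getD_eq_getElem _ _ hi]
    exact List.getElem_mem hi
  obtain ⟨x, hx, hxe⟩ := List.mem_map.1 hmem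
  rw [← hxe, Nat.one_le_iff_ne_zero, Finset.card_ne_zero]
  exact ⟨x, by simp [hx]⟩

theorem le_maxL_of_mem {u : List ℕ} {x : ℕ} (hx : x ∈ u) : x ≤ maxL u := by
  induction u with
  | nil => simp at hx
  | cons y t ih =>
    rcases List.mem_cons.1 hx with rfl | h
    · exact le_max_left _ _
    · exact (ih h).trans (le_max_right _ _)

theorem getD_le_maxL (u : List ℕ) (i : ℕ) : u.getD i 0 ≤ maxL u := by
  rcases lt_or_ge i u.length with hi | hi
  · rw [List.getD_eq_getElem _ _ hi]
    exact le_maxL_of_mem (List.getElem_mem hi)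
  · rw [List.getD_eq_default _ _ hi]
    exact Nat.zero_le _

theorem length_veeP (u v : List ℕ) : (veeP u v).length = u.length + (v.length - 1) := by
  simp [veeP]

theorem getD_veeP_left (u v : List ℕ) {i : ℕ} (hi : i < u.length) :
    (veeP u v).getD i 0 =
      if u.getD i 0 ≤ u.getD (u.length - 1) 0 then u.getD i 0 + v.getD 0 0 - 1
      else u.getD i 0 + maxL v - 1 := by
  rw [veeP, List.getD_append _ _ _ _ (by simpa using hi),
    List.getD_eq_getElem _ _ (by simpa using hi), List.getElem_map,
    List.getD_eq_getElem u _ hi]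

theorem getD_veeP_right (u v : List ℕ) {i : ℕ} (hi : i + 1 < v.length) :
    (veeP u v).getD (u.length + i) 0 =
      if v.getD (i + 1) 0 < v.getD 0 0 then v.getD (i + 1) 0
      else v.getD (i + 1) 0 + u.getD (u.length - 1) 0 - 1 := by
  rw [veeP, List.getD_append_right _ _ _ _ (by simp), List.length_map, Nat.add_sub_cancel_left,
    List.getD_eq_getElem _ _ (by simp; omega), List.getElem_map, List.getElem_drop,
    List.getD_eq_getElem v _ hi]
  simp only [add_comm 1 i]

/-- if `u` and `v` are packed words that each avoid all four patterns
132, 213, 121 and 212, then `u ∨ v` avoids all four patterns 132, 213, 121 and 212.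
(This gives a direct proof that the free cubical trialgebra on one generator is
stable under the # product.) -/
theorem veeP_avoids_cubical_patterns (u v : List ℕ)
    (hu : IsPacked u) (hul : 1 ≤ u.length) (hv : IsPacked v) (hvl : 1 ≤ v.length)
    (hu132 : AvoidsPat u [1, 3, 2]) (hu213 : AvoidsPat u [2, 1, 3])
    (hu121 : AvoidsPat u [1, 2, 1]) (hu212 : AvoidsPat u [2, 1, 2])
    (hv132 : AvoidsPat v [1, 3, 2]) (hv213 : AvoidsPat v [2, 1, 3])
    (hv121 : AvoidsPat v [1, 2, 1]) (hv212 : AvoidsPat v [2, 1, 2]) :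
    AvoidsPat (veeP u v) [1, 3, 2] ∧ AvoidsPat (veeP u v) [2, 1, 3] ∧
      AvoidsPat (veeP u v) [1, 2, 1] ∧ AvoidsPat (veeP u v) [2, 1, 2] := by
  have hU := (avoidsPat_cubical_iff u).1 ⟨hu132, hu213, hu121, hu212⟩
  have hV := (avoidsPat_cubical_iff v).1 ⟨hv132, hv213, hv121, hv212⟩
  rw [avoidsPat_cubical_iff]
  intro i j m hij hjm hm
  rw [length_veeP] at hm
  have hlast := hu.one_le_getD (i := u.length - 1) (by omega)
  have hhead := hv.one_le_getD (i := 0) (by omega)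
  have hmax := getD_le_maxL v 0
  rcases lt_or_ge m u.length with hmu | hmu
  · have := hU i j m hij hjm hmu
    have := hu.one_le_getD (i := i) (by omega)
    have := hu.one_le_getD (i := j) (by omega)
    have := hu.one_le_getD hmu
    rw [getD_veeP_left u v (i := i) (by omega), getD_veeP_left u v (i := j) (by omega),
      getD_veeP_left u v hmu]
    split_ifs <;> omega
  obtain ⟨m, rfl⟩ := Nat.exists_eq_add_of_le hmu
  have hmv : m + 1 < v.length := by omega
  have := hv.one_le_getD hmv
  have := getD_le_maxL v (m + 1)
  rw [getD_veeP_right u v hmv]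
  rcases lt_or_ge j u.length with hju | hju
  · have hUij : u.getD i 0 ≤ u.getD (u.length - 1) 0 →
        u.getD i 0 ≤ u.getD j 0 ∧ u.getD j 0 ≤ u.getD (u.length - 1) 0 := by
      rcases Nat.lt_or_ge j (u.length - 1) with h | h
      · exact hU i j _ hij h (by omega)
      · obtain rfl : j = u.length - 1 := by omega
        exact fun h => ⟨h, le_rfl⟩
    have := hu.one_le_getD (i := i) (by omega)
    rw [getD_veeP_left u v (i := i) (by omega), getD_veeP_left u v hju]
    split_ifs <;> omega
  obtain ⟨j, rfl⟩ := Nat.exists_eq_add_of_le hju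
  have := hv.one_le_getD (i := j + 1) (by omega)
  rw [getD_veeP_right u v (i := j) (by omega)]
  rcases lt_or_ge i u.length with hiu | hiu
  · have := hV 0 (j + 1) (m + 1) (by omega) (by omega) hmv
    have := hu.one_le_getD hiu
    rw [getD_veeP_left u v hiu]
    split_ifs <;> omega
  · obtain ⟨i, rfl⟩ := Nat.exists_eq_add_of_le hiu
    have := hV (i + 1) (j + 1) (m + 1) (by omega) (by omega) hmv
    rw [getD_veeP_right u v (i := i) (by omega)]
    split_ifs <;> omega
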